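/- Let 0 < a < π√3/4, let Δ = Δ_hex(a) be the hexagonal lattice ℤ·(2a,0) + ℤ·(a, a√3), let Λ = (2Δ) × 2πℤ ⊂ ℝ³, and let σ₀ : ℝ³ → ℝ³ be the screw motion σ₀(x,y,z) = (−x, −y, z + π). Then the infimum of L_Δ(γ) over all v ∈ Λ, all m ∈ ℝ³ and all piecewise C¹ curves γ : [0,1] → ℝ³ with γ(0) = m and γ(1) = σ₀(m) + v equals π. (In the singular torus (T, g_hex) = (ℝ³,h)/Λ this says dist(m, σ(m)) ≥ π for every point m, with equality achieved along a geodesic of a surface θ = constant.) -/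

import Mathlib

open Real MeasureTheory Set

noncomputable section

/-- The point `(x, y)` of the Euclidean plane. -/
def pt2 (x y : ℝ) : EuclideanSpace ℝ (Fin 2) := (WithLp.equiv 2 (Fin 2 → ℝ)).symm ![x, y]

/-- `f : [0,1] → ℝ` is piecewise `C¹`. -/
def PC1 (f : ℝ → ℝ) : Prop :=
  ∃ (n : ℕ) (t : ℕ → ℝ), t 0 = 0 ∧ t n = 1 ∧ (∀ i < n, t i < t (i + 1)) ∧
    ContinuousOn f (Set.Icc 0 1) ∧ ∀ i < n, ContDiffOn ℝ 1 f (Set.Icc (t i) (t (i + 1)))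

/-- Length of `γ = (γ₁,γ₂,γ₃)` for the singular metric
`h = dx² + dy² + cos²(dist((x,y),Δ)) dz²`. -/
def sLen (Δ : Set (EuclideanSpace ℝ (Fin 2))) (γ₁ γ₂ γ₃ : ℝ → ℝ) : ℝ :=
  ∫ t in (0:ℝ)..1, Real.sqrt ((deriv γ₁ t) ^ 2 + (deriv γ₂ t) ^ 2 +
    Real.cos (Metric.infDist (pt2 (γ₁ t) (γ₂ t)) Δ) ^ 2 * (deriv γ₃ t) ^ 2)

/-- The hexagonal lattice `Δ_hex(a) = ℤ·(2a,0) + ℤ·(a, a√3) ⊂ ℝ²`. -/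
def ΔhexE (a : ℝ) : Set (EuclideanSpace ℝ (Fin 2)) :=
  {p | ∃ m n : ℤ, p = pt2 (2 * a * m + a * n) (a * Real.sqrt 3 * n)}

/-- The spatial lattice `Λ = (2Δ_hex(a)) × 2πℤ ⊂ ℝ³`, generated by `(4a,0,0)`,
`(2a, 2a√3, 0)` and `(0,0,2π)`. -/
def Λhex3 (a : ℝ) : Set (ℝ × ℝ × ℝ) :=
  {w | ∃ k₁ k₂ k₃ : ℤ, w = (4 * a * k₁ + 2 * a * k₂, 2 * a * Real.sqrt 3 * k₂, 2 * π * k₃)}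

/-- The screw motion `σ₀(x,y,z) = (−x, −y, z + π)`. -/
def sigma0 (p : ℝ × ℝ × ℝ) : ℝ × ℝ × ℝ := (-p.1, -p.2.1, p.2.2 + π)

/-- The colatitude used to map the plane to the round sphere: the distance to the origin, capped
at `π / 2`. -/
def cappedRadius (x y : ℝ) : ℝ := min √(x ^ 2 + y ^ 2) (π / 2)

/-- The map `(r, θ, z) ↦ (sin ρ e^{iθ}, cos ρ e^{iz})` with `ρ = min r (π / 2)` into `S³ ⊂ ℝ⁴`,
where `(r, θ)` are the polar coordinates of `(x, y)`. -/
def toSphere (x y z : ℝ) : EuclideanSpace ℝ (Fin 4) :=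
  !₂[Real.sin (cappedRadius x y) / √(x ^ 2 + y ^ 2) * x,
    Real.sin (cappedRadius x y) / √(x ^ 2 + y ^ 2) * y,
    Real.cos (cappedRadius x y) * Real.cos z, Real.cos (cappedRadius x y) * Real.sin z]

lemma cappedRadius_nonneg (x y : ℝ) : 0 ≤ cappedRadius x y :=
  le_min (Real.sqrt_nonneg _) (by positivity)

lemma cos_cappedRadius_nonneg (x y : ℝ) : 0 ≤ Real.cos (cappedRadius x y) :=
  Real.cos_nonneg_of_mem_Icc
    ⟨by linarith [cappedRadius_nonneg x y, Real.pi_pos], min_le_right _ _⟩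

lemma sin_cappedRadius_nonneg (x y : ℝ) : 0 ≤ Real.sin (cappedRadius x y) :=
  Real.sin_nonneg_of_nonneg_of_le_pi (cappedRadius_nonneg x y)
    ((min_le_right _ _).trans (by linarith [Real.pi_pos]))

lemma sin_cappedRadius_div_mul (x y : ℝ) :
    Real.sin (cappedRadius x y) / √(x ^ 2 + y ^ 2) * √(x ^ 2 + y ^ 2) =
      Real.sin (cappedRadius x y) := by
  by_cases h : √(x ^ 2 + y ^ 2) = 0
  · have : cappedRadius x y = 0 := by
      rw [cappedRadius, h]; exact min_eq_left (by positivity)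
    simp [this]
  · exact div_mul_cancel₀ _ h

lemma sin_cappedRadius_div_le_one (x y : ℝ) :
    Real.sin (cappedRadius x y) / √(x ^ 2 + y ^ 2) ≤ 1 :=
  div_le_one_of_le₀ ((Real.sin_le (cappedRadius_nonneg x y)).trans (min_le_left _ _))
    (Real.sqrt_nonneg _)

lemma inner_toSphere (x y z x' y' z' : ℝ) :
    inner ℝ (toSphere x y z) (toSphere x' y' z') =
      Real.sin (cappedRadius x y) / √(x ^ 2 + y ^ 2) *
        (Real.sin (cappedRadius x' y') / √(x' ^ 2 + y' ^ 2)) * (x * x' + y * y') +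
      Real.cos (cappedRadius x y) * Real.cos (cappedRadius x' y') * Real.cos (z - z') := by
  simp only [toSphere, PiLp.inner_apply, Fin.sum_univ_four, Real.cos_sub]
  simp
  ring

lemma norm_toSphere (x y z : ℝ) : ‖toSphere x y z‖ = 1 := by
  have h := inner_toSphere x y z x y z
  have h1 := sin_cappedRadius_div_mul x y
  have h2 : √(x ^ 2 + y ^ 2) * √(x ^ 2 + y ^ 2) = x * x + y * y := by
    rw [Real.mul_self_sqrt (by positivity)]; ring
  rw [real_inner_self_eq_norm_sq, ← h2, sub_self, Real.cos_zero] at h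
  have h3 : ‖toSphere x y z‖ ^ 2 = 1 := by
    rw [h]
    linear_combination (Real.sin (cappedRadius x y) / √(x ^ 2 + y ^ 2) * √(x ^ 2 + y ^ 2) +
      Real.sin (cappedRadius x y)) * h1 +
      Real.sin_sq_add_cos_sq (cappedRadius x y)
  exact (sq_eq_sq₀ (norm_nonneg _) zero_le_one).1 (by simpa using h3)

lemma two_sub_two_mul_inner_toSphere_le (x y z x' y' z' : ℝ) :
    2 - 2 * inner ℝ (toSphere x y z) (toSphere x' y' z') ≤
      (x - x') ^ 2 + (y - y') ^ 2 +
        Real.cos (cappedRadius x y) * Real.cos (cappedRadius x' y') * (z - z') ^ 2 := by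
  rw [inner_toSphere]
  have hψ1 := sin_cappedRadius_div_mul x y
  have hψ2 := sin_cappedRadius_div_mul x' y'
  have hψ3 := sin_cappedRadius_div_le_one x y
  have hψ4 := sin_cappedRadius_div_le_one x' y'
  have hψ5 : 0 ≤ Real.sin (cappedRadius x y) / √(x ^ 2 + y ^ 2) :=
    div_nonneg (sin_cappedRadius_nonneg x y) (Real.sqrt_nonneg _)
  have hψ6 : 0 ≤ Real.sin (cappedRadius x' y') / √(x' ^ 2 + y' ^ 2) :=
    div_nonneg (sin_cappedRadius_nonneg x' y') (Real.sqrt_nonneg _)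
  have hc := mul_nonneg (cos_cappedRadius_nonneg x y) (cos_cappedRadius_nonneg x' y')
  have hρ : (cappedRadius x y - cappedRadius x' y') ^ 2 ≤
      (√(x ^ 2 + y ^ 2) - √(x' ^ 2 + y' ^ 2)) ^ 2 := by
    refine sq_le_sq.2 ?_
    simpa [cappedRadius] using
      abs_min_sub_min_le_max √(x ^ 2 + y ^ 2) (π / 2) √(x' ^ 2 + y' ^ 2) (π / 2)
  have hcs := Real.one_sub_sq_div_two_le_cos (x := cappedRadius x y - cappedRadius x' y')
  rw [Real.cos_sub] at hcs
  have hz := mul_nonneg hc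
    (sub_nonneg.2 (Real.one_sub_sq_div_two_le_cos (x := z - z')))
  have hr1 : √(x ^ 2 + y ^ 2) ^ 2 = x ^ 2 + y ^ 2 := Real.sq_sqrt (by positivity)
  have hr2 : √(x' ^ 2 + y' ^ 2) ^ 2 = x' ^ 2 + y' ^ 2 := Real.sq_sqrt (by positivity)
  have hip : x * x' + y * y' ≤ √(x ^ 2 + y ^ 2) * √(x' ^ 2 + y' ^ 2) := by
    rw [← Real.sqrt_mul (by positivity)]
    exact Real.le_sqrt_of_sq_le (by nlinarith [sq_nonneg (x * y' - y * x')])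
  have hψ7 := mul_le_one₀ hψ3 hψ6 hψ4
  have hmul := mul_le_mul_of_nonneg_right hψ7 (sub_nonneg.2 hip)
  generalize √(x ^ 2 + y ^ 2) = r at *
  generalize √(x' ^ 2 + y' ^ 2) = r' at *
  generalize Real.sin (cappedRadius x y) / r = ψ at *
  generalize Real.sin (cappedRadius x' y') / r' = ψ' at *
  rw [← hψ1, ← hψ2] at hcs
  nlinarith

lemma toSphere_neg (x y z : ℝ) (k : ℤ) :
    toSphere (-x) (-y) (z + π + 2 * π * k) = -toSphere x y z := by
  have h : z + π + 2 * π * k = (z + π) + k * (2 * π) := by ring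
  have hcos := Real.cos_add_int_mul_two_pi (z + π) k
  have hsin := Real.sin_add_int_mul_two_pi (z + π) k
  rw [← h, Real.cos_add_pi] at hcos
  rw [← h, Real.sin_add_pi] at hsin
  have hρ : cappedRadius (-x) (-y) = cappedRadius x y := by simp [cappedRadius]
  ext i
  fin_cases i <;> simp [toSphere, hρ, hcos, hsin]

/-- The cosine weight of the singular metric dominates the one of the sphere as soon as the
distance function is at most the distance to the origin. -/
lemma cos_cappedRadius_sq_le {x y d : ℝ} (hd0 : 0 ≤ d) (hd : d ≤ √(x ^ 2 + y ^ 2)) :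
    Real.cos (cappedRadius x y) ^ 2 ≤ Real.cos d ^ 2 := by
  rcases le_total √(x ^ 2 + y ^ 2) (π / 2) with h | h
  · have hρ : cappedRadius x y = √(x ^ 2 + y ^ 2) := min_eq_left h
    refine pow_le_pow_left₀ (cos_cappedRadius_nonneg x y) ?_ 2
    rw [hρ]
    exact Real.cos_le_cos_of_nonneg_of_le_pi hd0 (by linarith [Real.pi_pos]) hd
  · have hρ : cappedRadius x y = π / 2 := min_eq_right h
    rw [hρ, Real.cos_pi_div_two, zero_pow two_ne_zero]
    positivity

/-- The angles from a fixed point of the sphere satisfy the chordal Lipschitz bound. -/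
lemma two_sub_two_mul_cos_angle_sub_le (p : EuclideanSpace ℝ (Fin 4)) (x y z x' y' z' : ℝ) :
    2 - 2 * Real.cos (InnerProductGeometry.angle p (toSphere x y z) -
        InnerProductGeometry.angle p (toSphere x' y' z')) ≤
      (x - x') ^ 2 + (y - y') ^ 2 +
        Real.cos (cappedRadius x y) * Real.cos (cappedRadius x' y') * (z - z') ^ 2 := by
  refine le_trans ?_ (two_sub_two_mul_inner_toSphere_le x y z x' y' z')
  set u := toSphere x y z with hu
  set v := toSphere x' y' z' with hv
  have h1 := InnerProductGeometry.angle_le_angle_add_angle p u v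
  have h2 := InnerProductGeometry.angle_le_angle_add_angle p v u
  rw [InnerProductGeometry.angle_comm v u] at h2
  have h3 : |InnerProductGeometry.angle p u - InnerProductGeometry.angle p v| ≤
      InnerProductGeometry.angle u v := abs_le.2 ⟨by linarith, by linarith⟩
  have h4 := Real.cos_le_cos_of_nonneg_of_le_pi (abs_nonneg _)
    (InnerProductGeometry.angle_le_pi u v) h3
  rw [Real.cos_abs, InnerProductGeometry.cos_angle, hu, hv, norm_toSphere, norm_toSphere,
    ← hu, ← hv] at h4
  linarith

lemma two_sub_two_mul_cos (x : ℝ) : 2 - 2 * Real.cos x = (2 * Real.sin (x / 2)) ^ 2 := by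
  have h := Real.cos_sq' (x / 2)
  have h' := Real.cos_sq (x / 2)
  rw [show 2 * (x / 2) = x by ring] at h'
  linarith

lemma exists_lipschitzOnWith_Icc_of_PC1 {f : ℝ → ℝ} (hf : PC1 f) :
    ∃ K, LipschitzOnWith K f (Icc 0 1) := by
  obtain ⟨n, t, h0, h1, hlt, -, hC⟩ := hf
  suffices H : ∀ i ≤ n, 0 ≤ t i ∧ ∃ K, LipschitzOnWith K f (Icc 0 (t i)) by
    simpa [h1] using (H n le_rfl).2
  intro i
  induction i with
  | zero =>
    intro _
    refine ⟨h0.ge, 0, ?_⟩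
    rw [h0, Icc_self]
    exact LipschitzOnWith.of_dist_le_mul fun x hx y hy => by
      rw [mem_singleton_iff.1 hx, mem_singleton_iff.1 hy]; simp
  | succ i ih =>
    intro hi
    obtain ⟨hti, K, hK⟩ := ih (by omega)
    have hlti := hlt i (by omega)
    refine ⟨hti.trans hlti.le, ?_⟩
    obtain ⟨K', hK'⟩ : ∃ K', LipschitzOnWith K' f (Icc (t i) (t (i + 1))) :=
      (hC i (by omega)).exists_lipschitzOnWith one_ne_zero (convex_Icc _ _) isCompact_Icc
    refine ⟨max K K', ?_⟩
    have hA := hK.weaken (le_max_left K K')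
    have hB := hK'.weaken (le_max_right K K')
    have key : ∀ x ∈ Icc 0 (t (i + 1)), ∀ y ∈ Icc 0 (t (i + 1)), x ≤ y →
        dist (f x) (f y) ≤ (max K K' : NNReal) * dist x y := by
      intro x hx y hy hxy
      rcases le_total y (t i) with hy' | hy'
      · exact hA.dist_le_mul x ⟨hx.1, hxy.trans hy'⟩ y ⟨hy.1, hy'⟩
      rcases le_total (t i) x with hx' | hx'
      · exact hB.dist_le_mul x ⟨hx', hx.2⟩ y ⟨hy', hy.2⟩
      have e1 := hA.dist_le_mul x ⟨hx.1, hx'⟩ (t i) ⟨hti, le_rfl⟩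
      have e2 := hB.dist_le_mul (t i) ⟨le_rfl, hlti.le⟩ y ⟨hy', hy.2⟩
      have e3 : dist x y = dist x (t i) + dist (t i) y := by
        rw [Real.dist_eq, Real.dist_eq, Real.dist_eq, abs_of_nonpos (by linarith),
          abs_of_nonpos (by linarith), abs_of_nonpos (by linarith)]
        ring
      rw [e3, mul_add]
      exact (dist_triangle _ _ _).trans (add_le_add e1 e2)
    refine LipschitzOnWith.of_dist_le_mul fun x hx y hy => ?_
    rcases le_total x y with h | h
    · exact key x hx y hy h
    · rw [dist_comm, dist_comm x]; exact key y hy x hx h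

/-- A function whose increments satisfy the chordal bound of the sphere is Lipschitz. -/
lemma exists_lipschitzOnWith_of_chord {s : Set ℝ} {g x y z w : ℝ → ℝ} {K₁ K₂ K₃ : NNReal}
    (hx : LipschitzOnWith K₁ x s) (hy : LipschitzOnWith K₂ y s) (hz : LipschitzOnWith K₃ z s)
    (hw0 : ∀ t, 0 ≤ w t) (hw1 : ∀ t, w t ≤ 1) (hg : ∀ t, g t ∈ Icc 0 π)
    (h : ∀ t t', 2 - 2 * Real.cos (g t - g t') ≤
      (x t - x t') ^ 2 + (y t - y t') ^ 2 + w t * w t' * (z t - z t') ^ 2) :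
    ∃ K, LipschitzOnWith K g s := by
  refine ⟨NNReal.pi / 2 * (K₁ + K₂ + K₃),
    LipschitzOnWith.of_dist_le_mul fun t ht t' ht' => ?_⟩
  have e1 := hx.dist_le_mul t ht t' ht'
  have e2 := hy.dist_le_mul t ht t' ht'
  have e3 := hz.dist_le_mul t ht t' ht'
  have e4 := h t t'
  rw [two_sub_two_mul_cos] at e4
  rw [Real.dist_eq] at e1 e2 e3 ⊢
  have e5 : |(g t - g t') / 2| ≤ π / 2 := by
    rw [abs_le]
    constructor <;> linarith [(hg t).1, (hg t).2, (hg t').1, (hg t').2]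
  have e6 := Real.mul_abs_le_abs_sin e5
  have e7 : w t * w t' * (z t - z t') ^ 2 ≤ (z t - z t') ^ 2 :=
    mul_le_of_le_one_left (sq_nonneg _) (mul_le_one₀ (hw1 t) (hw0 t') (hw1 t'))
  have e8 : |2 * Real.sin ((g t - g t') / 2)| ≤ |x t - x t'| + |y t - y t'| + |z t - z t'| := by
    refine abs_le_of_sq_le_sq (e4.trans ?_) (by positivity)
    rw [← sq_abs (x t - x t'), ← sq_abs (y t - y t')]
    rw [← sq_abs (z t - z t')] at e7 ⊢
    nlinarith [mul_nonneg (abs_nonneg (x t - x t')) (abs_nonneg (y t - y t')),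
      mul_nonneg (abs_nonneg (x t - x t')) (abs_nonneg (z t - z t')),
      mul_nonneg (abs_nonneg (y t - y t')) (abs_nonneg (z t - z t'))]
  rw [abs_mul, abs_two] at e8
  rw [abs_div, abs_two] at e6
  have e9 : |g t - g t'| = π / 2 * (2 * (2 / π * (|g t - g t'| / 2))) := by
    field_simp
  rw [e9]
  push_cast
  rw [NNReal.coe_real_pi, mul_assoc]
  refine mul_le_mul_of_nonneg_left ?_ (by positivity)
  linarith

/-- Infinitesimal form of the chordal bound. -/
lemma deriv_le_of_chord {g x y z w : ℝ → ℝ} {t : ℝ}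
    (hg : DifferentiableAt ℝ g t) (hx : DifferentiableAt ℝ x t) (hy : DifferentiableAt ℝ y t)
    (hz : DifferentiableAt ℝ z t) (hw : ContinuousAt w t)
    (h : ∀ s, 2 - 2 * Real.cos (g s - g t) ≤
      (x s - x t) ^ 2 + (y s - y t) ^ 2 + w s * w t * (z s - z t) ^ 2) :
    deriv g t ≤ √(deriv x t ^ 2 + deriv y t ^ 2 + w t ^ 2 * deriv z t ^ 2) := by
  refine Real.le_sqrt_of_sq_le ?_
  have hG : HasDerivAt (fun s => 2 * Real.sin ((g s - g t) / 2)) (deriv g t) t := by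
    have := ((hg.hasDerivAt.sub_const (g t)).div_const 2).sin.const_mul 2
    simpa [mul_div_cancel₀] using this
  have lg := (hasDerivAt_iff_tendsto_slope.1 hG).pow 2
  have lx := (hasDerivAt_iff_tendsto_slope.1 hx.hasDerivAt).pow 2
  have ly := (hasDerivAt_iff_tendsto_slope.1 hy.hasDerivAt).pow 2
  have lz := (hasDerivAt_iff_tendsto_slope.1 hz.hasDerivAt).pow 2
  have lw : Filter.Tendsto (fun s => w s * w t) (nhdsWithin t {t}ᶜ) (nhds (w t ^ 2)) := by
    rw [pow_two]
    exact (hw.tendsto.mono_left nhdsWithin_le_nhds).mul_const _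
  refine le_of_tendsto_of_tendsto lg ((lx.add ly).add (lw.mul lz)) ?_
  filter_upwards [self_mem_nhdsWithin] with s hs
  have hst : 0 < (s - t) ^ 2 := by
    have : s - t ≠ 0 := sub_ne_zero.2 hs
    positivity
  have := div_le_div_of_nonneg_right (h s) hst.le
  rw [two_sub_two_mul_cos] at this
  simp only [slope_def_field, sub_self, zero_div, Real.sin_zero, mul_zero, sub_zero, div_pow]
  refine this.trans (le_of_eq ?_)
  ring

lemma continuous_cappedRadius : Continuous fun p : ℝ × ℝ => cappedRadius p.1 p.2 := by
  unfold cappedRadius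
  fun_prop

lemma continuous_pt2 : Continuous fun p : ℝ × ℝ => pt2 p.1 p.2 := by
  refine (PiLp.continuous_toLp 2 _).comp (continuous_pi fun i => ?_)
  fin_cases i
  · exact continuous_fst
  · exact continuous_snd

lemma intervalIntegrable_speed {a b : ℝ} {f₁ f₂ f₃ c : ℝ → ℝ}
    (h₁ : IntervalIntegrable f₁ volume a b) (h₂ : IntervalIntegrable f₂ volume a b)
    (h₃ : IntervalIntegrable f₃ volume a b) (hc : ContinuousOn c (uIoc a b))
    (hc1 : ∀ t, |c t| ≤ 1) :
    IntervalIntegrable (fun t => √(f₁ t ^ 2 + f₂ t ^ 2 + c t ^ 2 * f₃ t ^ 2)) volume a b := by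
  refine ((h₁.abs.add h₂.abs).add h₃.abs).mono_fun ?_ (Filter.Eventually.of_forall fun t => ?_)
  · have m₁ := (intervalIntegrable_iff.1 h₁).aestronglyMeasurable
    have m₂ := (intervalIntegrable_iff.1 h₂).aestronglyMeasurable
    have m₃ := (intervalIntegrable_iff.1 h₃).aestronglyMeasurable
    have m := hc.aestronglyMeasurable (μ := volume) measurableSet_uIoc
    exact Real.continuous_sqrt.comp_aestronglyMeasurable
      (((m₁.pow 2).add (m₂.pow 2)).add ((m.pow 2).mul (m₃.pow 2)))
  · have hcos := mul_le_of_le_one_left (sq_nonneg (f₃ t)) ((sq_le_one_iff_abs_le_one _).2 (hc1 t))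
    simp only [Real.norm_eq_abs, abs_of_nonneg (Real.sqrt_nonneg _)]
    refine le_trans ?_ (le_abs_self _)
    refine Real.sqrt_le_iff.2 ⟨by positivity, ?_⟩
    rw [← sq_abs (f₁ t), ← sq_abs (f₂ t)]
    rw [← sq_abs (f₃ t)] at hcos ⊢
    nlinarith [mul_nonneg (abs_nonneg (f₁ t)) (abs_nonneg (f₂ t)),
      mul_nonneg (abs_nonneg (f₁ t)) (abs_nonneg (f₃ t)),
      mul_nonneg (abs_nonneg (f₂ t)) (abs_nonneg (f₃ t))]

/-- A function bounded by the chordal distance on the sphere varies by at most the length of the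
curve. -/
lemma sub_le_integral_speed_of_chord {g x y z w c : ℝ → ℝ} {K₁ K₂ K₃ : NNReal}
    (hx : LipschitzOnWith K₁ x (Icc 0 1)) (hy : LipschitzOnWith K₂ y (Icc 0 1))
    (hz : LipschitzOnWith K₃ z (Icc 0 1)) (hw0 : ∀ t, 0 ≤ w t) (hw1 : ∀ t, w t ≤ 1)
    (hg : ∀ t, g t ∈ Icc 0 π)
    (hw : ∀ t, ContinuousAt x t → ContinuousAt y t → ContinuousAt w t)
    (hc : ContinuousOn c (Icc 0 1)) (hc1 : ∀ t, |c t| ≤ 1) (hwc : ∀ t, w t ^ 2 ≤ c t ^ 2)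
    (h : ∀ t t', 2 - 2 * Real.cos (g t - g t') ≤
      (x t - x t') ^ 2 + (y t - y t') ^ 2 + w t * w t' * (z t - z t') ^ 2) :
    g 1 - g 0 ≤ ∫ t in (0 : ℝ)..1, √(deriv x t ^ 2 + deriv y t ^ 2 + c t ^ 2 * deriv z t ^ 2) := by
  obtain ⟨K, L⟩ := exists_lipschitzOnWith_of_chord hx hy hz hw0 hw1 hg h
  rw [← uIcc_of_le zero_le_one] at L hx hy hz hc
  have A := L.absolutelyContinuousOnInterval
  have A₁ := hx.absolutelyContinuousOnInterval
  have A₂ := hy.absolutelyContinuousOnInterval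
  have A₃ := hz.absolutelyContinuousOnInterval
  have hint := intervalIntegrable_speed A₁.intervalIntegrable_deriv A₂.intervalIntegrable_deriv
    A₃.intervalIntegrable_deriv (hc.mono uIoc_subset_uIcc) hc1
  rw [← A.integral_deriv_eq_sub]
  refine intervalIntegral.integral_mono_ae_restrict zero_le_one A.intervalIntegrable_deriv hint ?_
  refine (ae_restrict_iff' measurableSet_Icc).2 ?_
  filter_upwards [A.ae_differentiableAt, A₁.ae_differentiableAt, A₂.ae_differentiableAt,
    A₃.ae_differentiableAt] with t d d₁ d₂ d₃ ht
  rw [← uIcc_of_le zero_le_one] at ht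
  refine (deriv_le_of_chord (d ht) (d₁ ht) (d₂ ht) (d₃ ht)
    (hw t (d₁ ht).continuousAt (d₂ ht).continuousAt) fun s => h s t).trans ?_
  have := hwc t
  gcongr

/-- A curve joining a point to its image under the screw motion of axis `c + ℝ e₃`, with `c ∈ Δ`,
up to a vertical translation by a multiple of `2π`, has length at least `π`. -/
lemma pi_le_sLen {Δ : Set (EuclideanSpace ℝ (Fin 2))} {c₁ c₂ : ℝ} (hc : pt2 c₁ c₂ ∈ Δ)
    {γ₁ γ₂ γ₃ : ℝ → ℝ} (h₁ : PC1 γ₁) (h₂ : PC1 γ₂) (h₃ : PC1 γ₃) (k : ℤ)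
    (e₁ : γ₁ 1 = -γ₁ 0 + 2 * c₁) (e₂ : γ₂ 1 = -γ₂ 0 + 2 * c₂)
    (e₃ : γ₃ 1 = γ₃ 0 + π + 2 * π * k) :
    π ≤ sLen Δ γ₁ γ₂ γ₃ := by
  obtain ⟨K₁, L₁⟩ := exists_lipschitzOnWith_Icc_of_PC1 h₁
  obtain ⟨K₂, L₂⟩ := exists_lipschitzOnWith_Icc_of_PC1 h₂
  obtain ⟨K₃, L₃⟩ := exists_lipschitzOnWith_Icc_of_PC1 h₃
  set u : ℝ → EuclideanSpace ℝ (Fin 4) := fun t => toSphere (γ₁ t - c₁) (γ₂ t - c₂) (γ₃ t) with hu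
  set g : ℝ → ℝ := fun t => InnerProductGeometry.angle (u 0) (u t) with hg
  set w : ℝ → ℝ := fun t => Real.cos (cappedRadius (γ₁ t - c₁) (γ₂ t - c₂)) with hw
  have hu0 : u 0 ≠ 0 := by
    rw [← norm_ne_zero_iff]
    simp [hu, norm_toSphere]
  have hu1 : u 1 = -u 0 := by
    have := toSphere_neg (γ₁ 0 - c₁) (γ₂ 0 - c₂) (γ₃ 0) k
    simp only [hu]
    rw [← this, e₁, e₂, e₃]
    congr 1 <;> ring
  have hg0 : g 0 = 0 := InnerProductGeometry.angle_self hu0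
  have hg1 : g 1 = π := by
    simp only [hg, hu1]
    exact InnerProductGeometry.angle_self_neg_of_nonzero hu0
  have chord : ∀ t t', 2 - 2 * Real.cos (g t - g t') ≤
      (γ₁ t - γ₁ t') ^ 2 + (γ₂ t - γ₂ t') ^ 2 + w t * w t' * (γ₃ t - γ₃ t') ^ 2 := by
    intro t t'
    have := two_sub_two_mul_cos_angle_sub_le (u 0) (γ₁ t - c₁) (γ₂ t - c₂) (γ₃ t)
      (γ₁ t' - c₁) (γ₂ t' - c₂) (γ₃ t')
    simpa only [sub_sub_sub_cancel_right] using this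
  have hwc : ∀ t, w t ^ 2 ≤ Real.cos (Metric.infDist (pt2 (γ₁ t) (γ₂ t)) Δ) ^ 2 := fun t => by
    refine cos_cappedRadius_sq_le Metric.infDist_nonneg
      ((Metric.infDist_le_dist_of_mem hc).trans (le_of_eq ?_))
    simp [pt2, EuclideanSpace.dist_eq, Fin.sum_univ_two, Real.dist_eq, sq_abs]
  have hwt : ∀ t, ContinuousAt γ₁ t → ContinuousAt γ₂ t → ContinuousAt w t := fun t d₁ d₂ =>
    ContinuousAt.comp (f := fun s => (γ₁ s - c₁, γ₂ s - c₂))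
      (Real.continuous_cos.comp continuous_cappedRadius).continuousAt
      ((d₁.sub continuousAt_const).prodMk (d₂.sub continuousAt_const))
  have key := sub_le_integral_speed_of_chord L₁ L₂ L₃ (fun t => cos_cappedRadius_nonneg _ _)
    (fun t => Real.cos_le_one _)
    (fun t => ⟨InnerProductGeometry.angle_nonneg _ _, InnerProductGeometry.angle_le_pi _ _⟩) hwt
    ((Real.continuous_cos.comp ((Metric.continuous_infDist_pt Δ).comp
      continuous_pt2)).comp_continuousOn (L₁.continuousOn.prodMk L₂.continuousOn))
    (fun t => Real.abs_cos_le_one _) hwc chord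
  change g 1 - g 0 ≤ sLen Δ γ₁ γ₂ γ₃ at key
  rwa [hg0, hg1, sub_zero] at key

lemma PC1.of_contDiff {f : ℝ → ℝ} (hf : ContDiff ℝ 1 f) : PC1 f :=
  ⟨1, fun i => i, by simp, by simp, fun i _ => by simp, hf.continuous.continuousOn,
    fun _ _ => hf.contDiffOn⟩

/-- for `0 < a < π√3/4`, `Δ = Δ_hex(a)`, `Λ = (2Δ) × 2πℤ`, the infimum of
`L_Δ(γ)` over all `v ∈ Λ`, all `m ∈ ℝ³`, and all piecewise `C¹` curves `γ` from `m` to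
`σ₀(m) + v` equals `π`; i.e. in the singular torus `(T, g_hex)` one has
`dist(m, σ(m)) ≥ π` for all `m`, with equality achieved. -/
theorem distance_to_sigma_orbit_hexagonal (a : ℝ) (ha : 0 < a)
    (ha' : a < π * Real.sqrt 3 / 4) :
    sInf {L : ℝ | ∃ v ∈ Λhex3 a, ∃ γ₁ γ₂ γ₃ : ℝ → ℝ,
        PC1 γ₁ ∧ PC1 γ₂ ∧ PC1 γ₃ ∧
        (γ₁ 1, γ₂ 1, γ₃ 1) = sigma0 (γ₁ 0, γ₂ 0, γ₃ 0) + v ∧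
        L = sLen (ΔhexE a) γ₁ γ₂ γ₃} = π := by
  refine IsLeast.csInf_eq ⟨?_, ?_⟩
  · refine ⟨(0, 0, 0), ⟨0, 0, 0, by simp⟩, fun _ => 0, fun _ => 0, fun t => π * t,
      PC1.of_contDiff contDiff_const, PC1.of_contDiff contDiff_const,
      PC1.of_contDiff (by fun_prop), by simp [sigma0], ?_⟩
    have hmem : pt2 0 0 ∈ ΔhexE a := ⟨0, 0, by simp⟩
    have hderiv : ∀ t : ℝ, deriv (fun t => π * t) t = π := fun t => by
      simp
    simp [sLen, hderiv, Metric.infDist_zero_of_mem hmem, Real.sqrt_sq Real.pi_pos.le]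
  · rintro L ⟨v, ⟨k₁, k₂, k₃, rfl⟩, γ₁, γ₂, γ₃, h₁, h₂, h₃, he, rfl⟩
    simp only [sigma0, Prod.mk_add_mk, Prod.mk.injEq] at he
    obtain ⟨e₁, e₂, e₃⟩ := he
    have hc : pt2 (2 * a * k₁ + a * k₂) (a * √3 * k₂) ∈ ΔhexE a := ⟨k₁, k₂, rfl⟩
    refine pi_le_sLen hc h₁ h₂ h₃ k₃ ?_ ?_ e₃
    · rw [e₁]; ring
    · rw [e₂]; ring

end
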